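/- Let C : f = 0 be a reduced plane curve of degree d in P²(ℂ) whose partial derivatives f_x and f_y have no common factor and which does not contain the line L_z : z = 0 as an irreducible component. For k ≥ 2, let F_k be the product of k distinct reduced members of the pencil αf + βz^d, let F'_k = zF_k, and let δ = f_y∂_x − f_x∂_y. Then the curve 𝒞_k : F_k = 0 (resp. 𝒞'_k : F'_k = 0) is a minimal plus-one generated (MPOG) curve if and only if the ideal quotient K_{δ,F_k} = I_δ : (F_k) (resp. K_{δ,F'_k} = I_δ : (F'_k)) is generated by two elements, a linear form ℓ ∈ S₁ and a quadratic form q ∈ S₂. In that case the exponents of 𝒞_k are (d−1, (k−1)d+1, (k−1)d+2) (resp. the exponents of 𝒞'_k are (d−1, (k−1)d+2, (k−1)d+3)). -/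

import Mathlib

open MvPolynomial

noncomputable section

/-- `S = ℂ[x,y,z]`, with `x = X 0`, `y = X 1`, `z = X 2`. -/
abbrev S3 := MvPolynomial (Fin 3) ℂ

/-- The graded `S`-module `D_0(f)` of Jacobian syzygies of `f`. -/
def jacSyz (f : S3) : Submodule S3 (Fin 3 → S3) where
  carrier := {v | v 0 * pderiv 0 f + v 1 * pderiv 1 f + v 2 * pderiv 2 f = 0}
  add_mem' := by
    intro a b ha hb
    simp only [Set.mem_setOf_eq, Pi.add_apply] at *
    linear_combination ha + hb
  zero_mem' := by simp
  smul_mem' := by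
    intro c v hv
    simp only [Set.mem_setOf_eq, Pi.smul_apply, smul_eq_mul] at *
    linear_combination c * hv

/-- `v` is a minimal system of `m` homogeneous generators of `D_0(f)`, the generator
`v j` being a syzygy of degree `dd j`, and `dd` nondecreasing: this says that
`C : f = 0` is an `m`-syzygy curve with exponents `dd`. -/
structure IsMinGenSyz (f : S3) (m : ℕ) (dd : Fin m → ℕ) (v : Fin m → (Fin 3 → S3)) : Prop where
  mem : ∀ j, v j ∈ jacSyz f
  hom : ∀ j i, ((v j) i).IsHomogeneous (dd j)
  ne_zero : ∀ j, v j ≠ 0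
  span_eq : Submodule.span S3 (Set.range v) = jacSyz f
  minimal : ∀ j, v j ∉ Submodule.span S3 (v '' {j' | j' ≠ j})
  mono : Monotone dd

/-- `C : f = 0` is free with exponents `(d1, d2)`. -/
def IsFreeWith (f : S3) (d1 d2 : ℕ) : Prop := ∃ v, IsMinGenSyz f 2 ![d1, d2] v

/-- `C : f = 0` is a free curve (a 2-syzygy curve). -/
def IsFreeCurve (f : S3) : Prop := ∃ d1 d2, IsFreeWith f d1 d2

/-- `C : f = 0` of degree `d` is nearly free with exponents `(d1, d2)`:
a 3-syzygy curve with exponents `(d1, d2, d2)` and `d1 + d2 = d`. -/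
def IsNearlyFreeWith (f : S3) (d d1 d2 : ℕ) : Prop :=
  d1 + d2 = d ∧ ∃ v, IsMinGenSyz f 3 ![d1, d2, d2] v

/-- `C : f = 0` of degree `d` is a nearly free curve. -/
def IsNearlyFree (f : S3) (d : ℕ) : Prop := ∃ d1 d2, IsNearlyFreeWith f d d1 d2

/-- `C : f = 0` of degree `d` is plus-one generated with exponents `(d1, d2, d3)`:
a 3-syzygy curve with `d1 + d2 = d`. -/
def IsPOGWith (f : S3) (d d1 d2 d3 : ℕ) : Prop :=
  d1 + d2 = d ∧ ∃ v, IsMinGenSyz f 3 ![d1, d2, d3] v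

/-- `C : f = 0` of degree `d` is a plus-one generated curve. -/
def IsPOG (f : S3) (d : ℕ) : Prop := ∃ d1 d2 d3, IsPOGWith f d d1 d2 d3

/-- `C : f = 0` of degree `d` is minimal plus-one generated (MPOG),
with exponents `(d1, d2, d2 + 1)`. -/
def IsMPOGWith (f : S3) (d d1 d2 : ℕ) : Prop := IsPOGWith f d d1 d2 (d2 + 1)

/-- `C : f = 0` of degree `d` is an MPOG-curve. -/
def IsMPOG (f : S3) (d : ℕ) : Prop := ∃ d1 d2, IsMPOGWith f d d1 d2

/-- `r = mdr(f)`: the minimal degree of a nonzero (homogeneous) Jacobian relation for `f`. -/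
def IsMDR (f : S3) (r : ℕ) : Prop :=
  (∃ v ∈ jacSyz f, v ≠ 0 ∧ ∀ i, (v i).IsHomogeneous r) ∧
  ∀ m, m < r → ∀ v ∈ jacSyz f, (∀ i, (v i).IsHomogeneous m) → v = 0

/-- The Jacobian ideal `J_f` of `f`. -/
def jacobianIdeal (f : S3) : Ideal S3 := Ideal.span {pderiv 0 f, pderiv 1 f, pderiv 2 f}

/-- The dimension of the degree `k` graded piece of the Milnor algebra `M(f) = S/J_f`. -/
def milnorDim (f : S3) (k : ℕ) : ℕ :=
  Module.finrank ℂ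
    (↥(homogeneousSubmodule (Fin 3) ℂ k) ⧸
      (Submodule.comap (homogeneousSubmodule (Fin 3) ℂ k).subtype
        (Submodule.restrictScalars ℂ (jacobianIdeal f))))

/-- `τ` is the total Tjurina number of the reduced curve `C : f = 0`, i.e. the degree of the
Jacobian ideal `J_f`: for all large `k` one has `dim M(f)_k = τ`. -/
def IsTjurina (f : S3) (τ : ℕ) : Prop := ∀ᶠ k in Filter.atTop, milnorDim f k = τ

/-- `C : f = 0` is a maximal Tjurina curve of type `(d, r)`. -/
def IsMaxTjurina (f : S3) (d r : ℕ) : Prop :=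
  IsMDR f r ∧ d ≤ 2 * r ∧
  ∃ τ : ℕ, IsTjurina f τ ∧
    (τ : ℤ) = ((d : ℤ) - 1) ^ 2 - r * ((d : ℤ) - r - 1) - (Nat.choose (2 * r + 2 - d) 2 : ℤ)

/-- `f` is a product of `d` linear forms all vanishing at a common point, i.e.
`C : f = 0` is the union of `d` lines passing through one point. -/
def IsUnionOfConcurrentLines (f : S3) (d : ℕ) : Prop :=
  ∃ (c : ℂ) (L : Fin d → Fin 3 → ℂ) (v : Fin 3 → ℂ), v ≠ 0 ∧
    f = C c * ∏ j, (∑ i, C (L j i) * X i) ∧ ∀ j, (∑ i, L j i * v i) = 0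

/-- The ideal `I_θ` generated by the 2×2 minors of the matrix with rows `(x,y,z)` and
`(a,b,c)`, defining the eigenscheme `Γ_θ` of the derivation `θ = a ∂_x + b ∂_y + c ∂_z`. -/
def eigenIdeal (a b c : S3) : Ideal S3 :=
  Ideal.span {X 1 * c - X 2 * b, X 2 * a - X 0 * c, X 0 * b - X 1 * a}

/-- The projective plane `ℙ²(ℂ)`. -/
abbrev Pt := Projectivization ℂ (Fin 3 → ℂ)

/-- The eigenscheme `Γ_θ` of `θ = a ∂_x + b ∂_y + c ∂_z` is 0-dimensional:
its set of points in `ℙ²` is finite. -/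
def EigenSchemeFinite (a b c : S3) : Prop :=
  {p : Pt | eval p.rep (X 1 * c - X 2 * b) = 0 ∧ eval p.rep (X 2 * a - X 0 * c) = 0 ∧
      eval p.rep (X 0 * b - X 1 * a) = 0}.Finite

section Grading

variable {σ : Type*} {R : Type*} [CommRing R]

attribute [local instance] gradedAlgebra

theorem coe_decompose_homogeneousSubmodule (g : MvPolynomial σ R) (n : ℕ) :
    (DirectSum.decompose (homogeneousSubmodule σ R) g n : MvPolynomial σ R) =
      homogeneousComponent n g :=
  decomposition.decompose'_apply g n

theorem homogeneousComponent_mul_of_le {g F : MvPolynomial σ R} {e n : ℕ}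
    (hF : F.IsHomogeneous e) (h : e ≤ n) :
    homogeneousComponent n (g * F) = homogeneousComponent (n - e) g * F := by
  have := DirectSum.coe_decompose_mul_of_right_mem_of_le (𝒜 := homogeneousSubmodule σ R)
    (a := g) (b := F) (i := e) (n := n) hF h
  simpa only [coe_decompose_homogeneousSubmodule] using this

theorem homogeneousComponent_mul_of_lt {g F : MvPolynomial σ R} {e n : ℕ}
    (hF : F.IsHomogeneous e) (h : n < e) :
    homogeneousComponent n (g * F) = 0 := by
  have := DirectSum.coe_decompose_mul_of_right_mem_of_not_le (𝒜 := homogeneousSubmodule σ R)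
    (a := g) (b := F) (i := e) (n := n) hF (by omega)
  simpa only [coe_decompose_homogeneousSubmodule] using this

theorem homogeneousComponent_mul_add {g F : MvPolynomial σ R} {e : ℕ}
    (hF : F.IsHomogeneous e) (n : ℕ) :
    homogeneousComponent (n + e) (g * F) = homogeneousComponent n g * F := by
  rw [homogeneousComponent_mul_of_le hF (by omega), Nat.add_sub_cancel]

theorem eq_zero_of_isHomogeneous_mul [IsDomain R] {g F : MvPolynomial σ R} {e n : ℕ}
    (hF : F.IsHomogeneous e) (hF0 : F ≠ 0) (hgF : (g * F).IsHomogeneous n) (h : n < e) :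
    g = 0 := by
  have h0 := homogeneousComponent_mul_of_lt (g := g) hF h
  rw [homogeneousComponent_eq_self hgF] at h0
  exact (mul_eq_zero.mp h0).resolve_right hF0

theorem isHomogeneous_of_mul [IsDomain R] {g F : MvPolynomial σ R} {e n : ℕ}
    (hF : F.IsHomogeneous e) (hF0 : F ≠ 0) (hgF : (g * F).IsHomogeneous (n + e)) :
    g.IsHomogeneous n := by
  have h0 := homogeneousComponent_mul_add (g := g) hF n
  rw [homogeneousComponent_eq_self hgF] at h0
  rw [mul_right_cancel₀ hF0 h0]
  exact homogeneousComponent_isHomogeneous n g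

theorem constantCoeff_of_isHomogeneous {g : MvPolynomial σ R} {n : ℕ}
    (hg : g.IsHomogeneous n) (hn : n ≠ 0) : constantCoeff g = 0 := by
  rw [constantCoeff_eq]
  exact hg.coeff_eq_zero (by simpa using hn.symm)

end Grading

section Squarefree

theorem dvd_of_squarefree_of_forall_dvd_mul {R ι : Type*} [CommRing R] [IsDomain R]
    [UniqueFactorizationMonoid R] {F h : R} (hF : Squarefree F) (m : ι → R)
    (hm : ∀ p, Prime p → p ∣ F → ∃ i, ¬ p ∣ m i) (hd : ∀ i, F ∣ m i * h) : F ∣ h := by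
  have key : ∀ p, Prime p → p ∣ F → p ∣ h := fun p hp hpF => by
    obtain ⟨i, hi⟩ := hm p hp hpF
    exact (hp.dvd_or_dvd (hpF.trans (hd i))).resolve_left hi
  clear hm hd
  induction F using WfDvdMonoid.induction_on_irreducible with
  | zero => exact absurd rfl hF.ne_zero
  | unit u hu => exact hu.dvd
  | mul G p hG hp ih =>
    exact (IsRelPrime.of_squarefree_mul hF).mul_dvd (key p hp.prime (Dvd.intro _ rfl))
      (ih hF.of_mul_right fun r hr hrG => key r hr (hrG.mul_left p))

theorem totalDegree_pderiv_lt {σ : Type*} {p : MvPolynomial σ ℂ} {i : σ} (h : pderiv i p ≠ 0) :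
    (pderiv i p).totalDegree < p.totalDegree := by
  obtain ⟨m, hm, hmd⟩ := Finset.exists_mem_eq_sup (pderiv i p).support
    (by simpa using h) (fun s => s.sum fun _ e => e)
  rw [totalDegree, hmd]
  rw [mem_support_iff, coeff_pderiv] at hm
  have := le_totalDegree (p := p) (s := m + Finsupp.single i 1)
    (by rw [mem_support_iff]; exact left_ne_zero_of_mul hm)
  rw [Finsupp.sum_add_index' (by simp) (by simp)] at this
  simp at this
  omega

theorem exists_not_dvd_pderiv {σ : Type*} {p : MvPolynomial σ ℂ} (hp : Prime p) :
    ∃ i, ¬ p ∣ pderiv i p := by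
  classical
  by_contra! hall
  have hzero : ∀ i, pderiv i p = 0 := by
    intro i
    by_contra hne
    obtain ⟨r, hr⟩ := hall i
    have hlt := totalDegree_pderiv_lt hne
    rw [hr] at hne
    rw [hr, totalDegree_mul_of_isDomain hp.ne_zero (right_ne_zero_of_mul hne)] at hlt
    omega
  have hconst : p = C (coeff 0 p) := by
    ext m
    rw [coeff_C]
    split_ifs with h0
    · rw [h0]
    · obtain ⟨i, hi⟩ := Finsupp.ne_iff.mp (Ne.symm h0)
      have h1 := coeff_pderiv (i := i) p (m - Finsupp.single i 1)
      rw [hzero i, coeff_zero, Finsupp.sub_add_single_one_cancel (by simpa using hi)] at h1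
      refine (mul_eq_zero.mp h1.symm).resolve_right ?_
      exact Nat.cast_add_one_ne_zero _
  apply hp.not_isUnit
  rw [hconst]
  refine (IsUnit.mk0 _ fun h => hp.ne_zero ?_).map C
  rw [hconst, h, C_0]

theorem exists_not_dvd_pderiv_of_squarefree {σ : Type*} {F p : MvPolynomial σ ℂ}
    (hF : Squarefree F) (hp : Prime p) (hpF : p ∣ F) : ∃ i, ¬ p ∣ pderiv i F := by
  obtain ⟨i, hi⟩ := exists_not_dvd_pderiv hp
  refine ⟨i, fun h => ?_⟩
  obtain ⟨G, rfl⟩ := hpF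
  rw [pderiv_mul] at h
  have h1 : p ∣ pderiv i p * G := (dvd_add_left (Dvd.intro _ rfl)).mp h
  rcases hp.dvd_or_dvd h1 with h2 | h2
  · exact hi h2
  · exact hp.not_isUnit (hF p (mul_dvd_mul_left p h2))

end Squarefree

theorem mem_span_image_ne_iff {R M ι : Type*} [CommRing R] [AddCommGroup M] [Module R M]
    [Fintype ι] [DecidableEq ι] {v : ι → M} {j : ι} {x : M} :
    x ∈ Submodule.span R (v '' {j' | j' ≠ j}) ↔ ∃ c : ι → R, c j = 0 ∧ ∑ i, c i • v i = x := by
  constructor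
  · intro hx
    induction hx using Submodule.span_induction with
    | mem y hy =>
      obtain ⟨i, hi, rfl⟩ := hy
      exact ⟨Pi.single i 1, Pi.single_eq_of_ne (Ne.symm hi) _, by simp [Pi.single_apply]⟩
    | zero => exact ⟨0, rfl, by simp⟩
    | add y z _ _ hy hz =>
      obtain ⟨a, ha, rfl⟩ := hy
      obtain ⟨b, hb, rfl⟩ := hz
      exact ⟨a + b, by simp [ha, hb], by simp [add_smul, Finset.sum_add_distrib]⟩
    | smul r y _ hy =>
      obtain ⟨a, ha, rfl⟩ := hy
      exact ⟨r • a, by simp [ha], by simp [Finset.smul_sum, mul_smul]⟩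
  · rintro ⟨c, hc, rfl⟩
    refine Submodule.sum_mem _ fun i _ => ?_
    by_cases hij : i = j
    · simp [hij, hc]
    · exact Submodule.smul_mem _ _ (Submodule.subset_span ⟨i, hij, rfl⟩)

/-- The derivation `δ = f_y ∂_x - f_x ∂_y` as a vector. -/
def hamVec (f : S3) : Fin 3 → S3 := ![pderiv 1 f, -pderiv 0 f, 0]

/-- The cross product of the Euler vector `(x, y, z)` with `hamVec f`. -/
def eigenMinors (f : S3) : Fin 3 → S3 :=
  ![X 2 * pderiv 0 f, X 2 * pderiv 1 f, -(X 0 * pderiv 0 f + X 1 * pderiv 1 f)]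

/-- The determinant with rows the Euler vector, `hamVec f` and `θ`, as a function of `θ`. -/
def eulerDet (f : S3) : (Fin 3 → S3) →ₗ[S3] S3 := Fintype.linearCombination S3 (eigenMinors f)

theorem eulerDet_apply (f : S3) (θ : Fin 3 → S3) :
    eulerDet f θ = ∑ i, θ i * eigenMinors f i := rfl

theorem eulerDet_eq (f : S3) (θ : Fin 3 → S3) :
    eulerDet f θ = θ 0 * (X 2 * pderiv 0 f) + θ 1 * (X 2 * pderiv 1 f)
      - θ 2 * (X 0 * pderiv 0 f + X 1 * pderiv 1 f) := by
  simp [eulerDet_apply, Fin.sum_univ_three, eigenMinors]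
  ring

theorem mem_jacSyz {F : S3} {θ : Fin 3 → S3} :
    θ ∈ jacSyz F ↔ ∑ i, θ i * pderiv i F = 0 := by
  rw [Fin.sum_univ_three]
  rfl

theorem mem_eigenIdeal {f g : S3} :
    g ∈ eigenIdeal (pderiv 1 f) (-(pderiv 0 f)) 0 ↔ ∃ θ, eulerDet f θ = g := by
  simp only [eigenIdeal, Ideal.span, Submodule.mem_span_triple, eulerDet_eq, smul_eq_mul]
  constructor
  · rintro ⟨a, b, c, rfl⟩
    exact ⟨![a, b, c], by simp; ring⟩
  · rintro ⟨θ, rfl⟩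
    exact ⟨θ 0, θ 1, θ 2, by ring⟩

theorem mem_colon_eigenIdeal {f F g : S3} :
    g ∈ Submodule.colon (eigenIdeal (pderiv 1 f) (-(pderiv 0 f)) 0) (Ideal.span {F}) ↔
      ∃ θ, eulerDet f θ = g * F := by
  rw [Ideal.mem_colon_span_singleton, mem_eigenIdeal]

section Components

variable {f F : S3} {d e : ℕ}

/-- The componentwise homogeneous component of degree `n` of a vector of polynomials. -/
def homComp (n : ℕ) (θ : Fin 3 → S3) : Fin 3 → S3 := fun i => homogeneousComponent n (θ i)

theorem sum_homComp_mul {c : Fin 3 → S3} {m : ℕ} (hc : ∀ i, (c i).IsHomogeneous m) (n : ℕ)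
    (θ : Fin 3 → S3) :
    ∑ i, homComp n θ i * c i = homogeneousComponent (n + m) (∑ i, θ i * c i) := by
  rw [map_sum]
  exact Finset.sum_congr rfl fun i _ => (homogeneousComponent_mul_add (hc i) n).symm

theorem homComp_mem_jacSyz (hF : F.IsHomogeneous e) (n : ℕ) {θ : Fin 3 → S3}
    (hθ : θ ∈ jacSyz F) : homComp n θ ∈ jacSyz F := by
  rw [mem_jacSyz] at hθ ⊢
  rw [sum_homComp_mul (fun i => hF.pderiv), hθ, map_zero]

theorem isHomogeneous_hamVec (hf : f.IsHomogeneous d) (i : Fin 3) :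
    (hamVec f i).IsHomogeneous (d - 1) := by
  fin_cases i
  · exact hf.pderiv
  · exact hf.pderiv.neg
  · exact isHomogeneous_zero _ _ _

theorem isHomogeneous_eigenMinors (hf : f.IsHomogeneous d) (hd : 1 ≤ d) (i : Fin 3) :
    (eigenMinors f i).IsHomogeneous d := by
  have h : ∀ a b : Fin 3, (X a * pderiv b f).IsHomogeneous d := fun a b => by
    have := (isHomogeneous_X ℂ a).mul (hf.pderiv (i := b))
    rwa [Nat.add_sub_cancel' hd] at this
  fin_cases i
  · exact h _ _
  · exact h _ _
  · exact ((h _ _).add (h _ _)).neg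

theorem eulerDet_homComp (hf : f.IsHomogeneous d) (hd : 1 ≤ d) (n : ℕ) (θ : Fin 3 → S3) :
    eulerDet f (homComp n θ) = homogeneousComponent (n + d) (eulerDet f θ) :=
  sum_homComp_mul (isHomogeneous_eigenMinors hf hd) n θ

theorem isHomogeneous_eulerDet (hf : f.IsHomogeneous d) (hd : 1 ≤ d) {n : ℕ} {θ : Fin 3 → S3}
    (hθ : ∀ i, (θ i).IsHomogeneous n) : (eulerDet f θ).IsHomogeneous (n + d) :=
  IsHomogeneous.sum _ _ _ fun i _ => (hθ i).mul (isHomogeneous_eigenMinors hf hd i)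

end Components

section Pencil

variable {f F : S3} {d e : ℕ}

theorem euler_identity (hF : F.IsHomogeneous e) :
    X 0 * pderiv 0 F + X 1 * pderiv 1 F + X 2 * pderiv 2 F = (e : S3) * F := by
  simpa [Fin.sum_univ_three] using hF.sum_X_mul_pderiv

theorem one_le_degree_of_coprime (hf : f.IsHomogeneous d)
    (hcop : ∀ p : S3, p ∣ pderiv 0 f → p ∣ pderiv 1 f → IsUnit p) : 1 ≤ d := by
  by_contra! h
  obtain rfl : d = 0 := by omega
  have hc : f = C (coeff 0 f) := by
    rw [← homogeneousComponent_zero, homogeneousComponent_eq_self hf]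
  refine not_isUnit_zero (hcop 0 ?_ ?_) <;> rw [hc, pderiv_C]

theorem exists_not_dvd_eigenMinors (hf : f.IsHomogeneous d)
    (hcop : ∀ p : S3, p ∣ pderiv 0 f → p ∣ pderiv 1 f → IsUnit p) (hz : ¬ (X 2 ∣ f))
    {p : S3} (hp : Prime p) : ∃ i, ¬ p ∣ eigenMinors f i := by
  have hd := one_le_degree_of_coprime hf hcop
  by_contra! h
  have h0 : p ∣ X 2 * pderiv 0 f := h 0
  have h1 : p ∣ X 2 * pderiv 1 f := h 1
  have h2 : p ∣ X 0 * pderiv 0 f + X 1 * pderiv 1 f := (dvd_neg).mp (h 2)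
  by_cases hpz : p ∣ X 2
  · have hzp : X 2 ∣ p := ((X_prime (R := ℂ)).irreducible.dvd_comm hp.irreducible).mpr hpz
    have h3 : (X 2 : S3) ∣ (d : S3) * f := by
      rw [← euler_identity hf]
      exact dvd_add (hzp.trans h2) (Dvd.intro _ rfl)
    rcases X_prime.dvd_or_dvd h3 with h4 | h4
    · have hu : IsUnit (d : S3) := by
        have := (IsUnit.mk0 (d : ℂ) (by exact_mod_cast (by omega : d ≠ 0))).map (C (σ := Fin 3))
        simpa using this
      exact (X_prime (R := ℂ)).not_isUnit (isUnit_of_dvd_unit h4 hu)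
    · exact hz h4
  · exact hp.not_isUnit (hcop p ((hp.dvd_or_dvd h0).resolve_left hpz)
      ((hp.dvd_or_dvd h1).resolve_left hpz))

theorem hamVec_ne_zero (hcop : ∀ p : S3, p ∣ pderiv 0 f → p ∣ pderiv 1 f → IsUnit p) :
    hamVec f ≠ 0 := by
  intro h
  have h0 : pderiv 1 f = 0 := congrFun h 0
  have h1 : -pderiv 0 f = 0 := congrFun h 1
  exact not_isUnit_zero (hcop 0 (by simp [neg_eq_zero.mp h1]) (by simp [h0]))

theorem eulerDet_hamVec : eulerDet f (hamVec f) = 0 := by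
  rw [eulerDet_eq]
  simp [hamVec]
  ring

theorem eulerDet_mul_pderiv (hF : F.IsHomogeneous e) (hδ : hamVec f ∈ jacSyz F)
    {θ : Fin 3 → S3} (hθ : θ ∈ jacSyz F) (i : Fin 3) :
    eulerDet f θ * pderiv i F = (e : S3) * F *
      (![-(pderiv 0 f * θ 2), -(pderiv 1 f * θ 2),
        pderiv 1 f * θ 1 + pderiv 0 f * θ 0] : Fin 3 → S3) i := by
  have hE := euler_identity hF
  have h1 : pderiv 1 f * pderiv 0 F + -pderiv 0 f * pderiv 1 F + 0 * pderiv 2 F = 0 := hδ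
  have h2 : θ 0 * pderiv 0 F + θ 1 * pderiv 1 F + θ 2 * pderiv 2 F = 0 := hθ
  rw [eulerDet_eq]
  fin_cases i <;> simp
  · linear_combination -(pderiv 0 f * θ 2) * hE + (θ 1 * X 2 - θ 2 * X 1) * h1
      + X 2 * pderiv 0 f * h2
  · linear_combination -(pderiv 1 f * θ 2) * hE + (θ 2 * X 0 - θ 0 * X 2) * h1
      + X 2 * pderiv 1 f * h2
  · linear_combination (pderiv 1 f * θ 1 + pderiv 0 f * θ 0) * hE
      + (θ 0 * X 1 - θ 1 * X 0) * h1 - (X 0 * pderiv 0 f + X 1 * pderiv 1 f) * h2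

theorem dvd_eulerDet (hF : F.IsHomogeneous e) (hsq : Squarefree F) (hδ : hamVec f ∈ jacSyz F)
    {θ : Fin 3 → S3} (hθ : θ ∈ jacSyz F) : ∃ g, eulerDet f θ = g * F := by
  have : F ∣ eulerDet f θ := by
    refine dvd_of_squarefree_of_forall_dvd_mul hsq (fun i => pderiv i F)
      (fun p hp hpF => exists_not_dvd_pderiv_of_squarefree hsq hp hpF) fun i => ?_
    rw [mul_comm, eulerDet_mul_pderiv hF hδ hθ]
    exact (Dvd.intro_left _ rfl).mul_right _
  obtain ⟨g, hg⟩ := this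
  exact ⟨g, by rw [hg, mul_comm]⟩

theorem exists_eq_smul_hamVec (hF : F.IsHomogeneous e) (hF0 : F ≠ 0) (he : e ≠ 0)
    (hcop : ∀ p : S3, p ∣ pderiv 0 f → p ∣ pderiv 1 f → IsUnit p)
    (hδ : hamVec f ∈ jacSyz F) {θ : Fin 3 → S3} (hθ : θ ∈ jacSyz F) (h0 : eulerDet f θ = 0) :
    ∃ h : S3, θ = h • hamVec f := by
  have heF : (e : S3) * F ≠ 0 := mul_ne_zero (by exact_mod_cast he) hF0
  have hc : ∀ i, (![-(pderiv 0 f * θ 2), -(pderiv 1 f * θ 2),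
      pderiv 1 f * θ 1 + pderiv 0 f * θ 0] : Fin 3 → S3) i = 0 := fun i => by
    have := eulerDet_mul_pderiv hF hδ hθ i
    rw [h0, zero_mul] at this
    exact (mul_eq_zero.mp this.symm).resolve_left heF
  have c0 : pderiv 0 f * θ 2 = 0 := neg_eq_zero.mp (hc 0)
  have c1 : pderiv 1 f * θ 2 = 0 := neg_eq_zero.mp (hc 1)
  have c2 : pderiv 1 f * θ 1 + pderiv 0 f * θ 0 = 0 := hc 2
  have hrel : IsRelPrime (pderiv 0 f) (pderiv 1 f) := fun p => hcop p
  by_cases hA : pderiv 0 f = 0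
  · have hB : IsUnit (pderiv 1 f) := hcop _ (by simp [hA]) dvd_rfl
    obtain ⟨b, hb⟩ := hB.exists_left_inv
    refine ⟨θ 0 * b, ?_⟩
    ext1 i
    fin_cases i
    · simp [hamVec, mul_assoc, hb]
    · simpa [hamVec, hA, hB.ne_zero] using c2
    · simpa [hamVec, hB.ne_zero] using c1
  · have hθ2 : θ 2 = 0 := (mul_eq_zero.mp c0).resolve_left hA
    have hdvd : pderiv 0 f ∣ pderiv 1 f * θ 1 := ⟨-θ 0, by linear_combination c2⟩
    obtain ⟨h, hh⟩ := hrel.dvd_of_dvd_mul_left hdvd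
    refine ⟨-h, ?_⟩
    ext1 i
    fin_cases i
    · refine mul_left_cancel₀ hA ?_
      simp [hamVec]
      linear_combination c2 - pderiv 1 f * hh
    · simp [hamVec, hh]
      ring
    · simpa [hamVec] using hθ2

theorem exists_mem_jacSyz_of_eulerDet (hf : f.IsHomogeneous d)
    (hcop : ∀ p : S3, p ∣ pderiv 0 f → p ∣ pderiv 1 f → IsUnit p) (hz : ¬ (X 2 ∣ f))
    (hF : F.IsHomogeneous e) (he : e ≠ 0) (hsq : Squarefree F) (hδ : hamVec f ∈ jacSyz F)
    {g : S3} {θ : Fin 3 → S3} (hθ : eulerDet f θ = g * F) :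
    ∃ η ∈ jacSyz F, eulerDet f η = g * F := by
  have hE := euler_identity hF
  have h1 : pderiv 1 f * pderiv 0 F + -pderiv 0 f * pderiv 1 F + 0 * pderiv 2 F = 0 := hδ
  have hdvd : F ∣ θ 0 * pderiv 0 F + θ 1 * pderiv 1 F + θ 2 * pderiv 2 F := by
    refine dvd_of_squarefree_of_forall_dvd_mul hsq (eigenMinors f)
      (fun p hp _ => exists_not_dvd_eigenMinors hf hcop hz hp) fun i => ?_
    rw [eulerDet_eq] at hθ
    fin_cases i
    · refine ⟨g * pderiv 0 F + pderiv 0 f * θ 2 * e, ?_⟩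
      simp [eigenMinors]
      linear_combination pderiv 0 F * hθ + (pderiv 0 f * θ 2) * hE
        - (θ 1 * X 2 - θ 2 * X 1) * h1
    · refine ⟨g * pderiv 1 F + pderiv 1 f * θ 2 * e, ?_⟩
      simp [eigenMinors]
      linear_combination pderiv 1 F * hθ + (pderiv 1 f * θ 2) * hE
        - (θ 2 * X 0 - θ 0 * X 2) * h1
    · refine ⟨g * pderiv 2 F - (pderiv 1 f * θ 1 + pderiv 0 f * θ 0) * e, ?_⟩
      simp [eigenMinors]
      linear_combination pderiv 2 F * hθ - (pderiv 1 f * θ 1 + pderiv 0 f * θ 0) * hE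
        - (θ 0 * X 1 - θ 1 * X 0) * h1
  obtain ⟨h, hh⟩ := hdvd
  have hinv : (C ((e : ℂ)⁻¹) : S3) * (e : S3) = 1 := by
    rw [← map_natCast (C (σ := Fin 3) (R := ℂ)), ← C_mul,
      inv_mul_cancel₀ (by exact_mod_cast he), C_1]
  refine ⟨θ - (C ((e : ℂ)⁻¹) * h) • X, ?_, ?_⟩
  · rw [mem_jacSyz, Fin.sum_univ_three]
    simp
    linear_combination hh - C ((e : ℂ)⁻¹) * h * hE - h * F * hinv
  · rw [map_sub, hθ, map_smul, eulerDet_eq f X]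
    simp
    right
    ring

end Pencil

section MinimalGenerators

variable {f F : S3} {d e : ℕ} {dd : Fin 3 → ℕ} {v : Fin 3 → Fin 3 → S3}

theorem IsMinGenSyz.exists_sum_eq (hv : IsMinGenSyz F 3 dd v) {x : Fin 3 → S3}
    (hx : x ∈ jacSyz F) : ∃ c : Fin 3 → S3, ∑ i, c i • v i = x := by
  rw [← hv.span_eq] at hx
  exact (Submodule.mem_span_range_iff_exists_fun _).mp hx

theorem IsMinGenSyz.exists_eq_smul_of_lt (hv : IsMinGenSyz F 3 dd v) {x : Fin 3 → S3}
    (hx : x ∈ jacSyz F) {n : ℕ} (hxn : ∀ i, (x i).IsHomogeneous n) (hn : n < dd 1) :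
    ∃ h : S3, x = h • v 0 := by
  obtain ⟨c, hc⟩ := hv.exists_sum_eq hx
  have hn2 : n < dd 2 := hn.trans_le (hv.mono (by decide))
  have key : ∀ i, x i = homogeneousComponent n (c 0 * v 0 i) := fun i => by
    have h := congrArg (homogeneousComponent n) (congrFun hc i)
    rw [homogeneousComponent_eq_self (hxn i)] at h
    simp only [Fin.sum_univ_three, Pi.add_apply, Pi.smul_apply, smul_eq_mul, map_add] at h
    rw [homogeneousComponent_mul_of_lt (hv.hom 1 i) hn,
      homogeneousComponent_mul_of_lt (hv.hom 2 i) hn2, add_zero, add_zero] at h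
    exact h.symm
  rcases le_or_gt (dd 0) n with h0 | h0
  · refine ⟨homogeneousComponent (n - dd 0) (c 0), funext fun i => ?_⟩
    rw [key, homogeneousComponent_mul_of_le (hv.hom 0 i) h0]
    rfl
  · refine ⟨0, funext fun i => ?_⟩
    rw [key, homogeneousComponent_mul_of_lt (hv.hom 0 i) h0]
    simp

theorem eq_zero_of_smul_isHomogeneous {h : S3} {x : Fin 3 → S3} {m n : ℕ}
    (hx : ∀ i, (x i).IsHomogeneous m) (hx0 : x ≠ 0) (hhx : ∀ i, ((h • x) i).IsHomogeneous n)
    (hnm : n < m) : h = 0 := by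
  obtain ⟨i, hi⟩ := Function.ne_iff.mp hx0
  exact eq_zero_of_isHomogeneous_mul (hx i) hi (hhx i) hnm

theorem IsMinGenSyz.degree_zero_le (hv : IsMinGenSyz F 3 dd v) {x : Fin 3 → S3}
    (hx : x ∈ jacSyz F) (hx0 : x ≠ 0) {n : ℕ} (hxn : ∀ i, (x i).IsHomogeneous n) :
    dd 0 ≤ n := by
  by_contra! h
  obtain ⟨c, rfl⟩ := hv.exists_eq_smul_of_lt hx hxn (h.trans_le (hv.mono (by decide)))
  exact hx0 (by rw [eq_zero_of_smul_isHomogeneous (hv.hom 0) (hv.ne_zero 0) hxn h, zero_smul])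

theorem not_isMPOG_of_degree_one (hf : f.IsHomogeneous 1)
    (hcop : ∀ p : S3, p ∣ pderiv 0 f → p ∣ pderiv 1 f → IsUnit p)
    (hF : F.IsHomogeneous e) (hF0 : F ≠ 0) (he : e ≠ 0) (hδ : hamVec f ∈ jacSyz F) :
    ¬ IsMPOG F e := by
  rintro ⟨d1, d2, hsum, v, hv⟩
  have hd1 : d1 ≤ 0 := hv.degree_zero_le hδ (hamVec_ne_zero hcop) (isHomogeneous_hamVec hf)
  have hd2 : e - 1 < d2 := by omega
  have hsmul : ∀ x ∈ jacSyz F, (∀ i, (x i).IsHomogeneous (e - 1)) → ∃ h : S3, x = h • v 0 :=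
    fun x hx hxn => hv.exists_eq_smul_of_lt hx hxn hd2
  obtain ⟨h, hh⟩ := hv.exists_eq_smul_of_lt hδ (isHomogeneous_hamVec hf)
    (show 1 - 1 < d2 by omega)
  have hh0 : h ≠ 0 := fun h0 => hamVec_ne_zero hcop (by rw [hh, h0, zero_smul])
  have hv2 : v 0 2 = 0 :=
    (mul_eq_zero.mp (show h * v 0 2 = 0 from (congrFun hh 2).symm)).resolve_left hh0
  obtain ⟨a, ha⟩ := hsmul ![pderiv 2 F, 0, -pderiv 0 F]
    (by rw [mem_jacSyz, Fin.sum_univ_three]; simp; ring)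
    (by intro i; fin_cases i
        exacts [hF.pderiv, isHomogeneous_zero _ _ _, hF.pderiv.neg])
  obtain ⟨b, hb⟩ := hsmul ![0, pderiv 2 F, -pderiv 1 F]
    (by rw [mem_jacSyz, Fin.sum_univ_three]; simp; ring)
    (by intro i; fin_cases i
        exacts [isHomogeneous_zero _ _ _, hF.pderiv, hF.pderiv.neg])
  have ha0 : pderiv 2 F = a * v 0 0 := congrFun ha 0
  have ha2 : -pderiv 0 F = a * v 0 2 := congrFun ha 2
  have hb0 : 0 = b * v 0 0 := congrFun hb 0
  have hb1 : pderiv 2 F = b * v 0 1 := congrFun hb 1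
  have hb2 : -pderiv 1 F = b * v 0 2 := congrFun hb 2
  have hF2 : pderiv 2 F = 0 := by
    rcases mul_eq_zero.mp hb0.symm with h1 | h1
    · rw [hb1, h1, zero_mul]
    · rw [ha0, h1, mul_zero]
  rw [hv2, mul_zero, neg_eq_zero] at ha2 hb2
  have hE := euler_identity hF
  rw [ha2, hb2, hF2] at hE
  refine mul_ne_zero (Nat.cast_ne_zero.mpr he) hF0 (hE.symm.trans ?_)
  simp

theorem colon_eq_span_of_isMPOG (hf : f.IsHomogeneous d)
    (hcop : ∀ p : S3, p ∣ pderiv 0 f → p ∣ pderiv 1 f → IsUnit p) (hz : ¬ (X 2 ∣ f))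
    (hF : F.IsHomogeneous e) (hde : 2 * d ≤ e) (hsq : Squarefree F) (hδ : hamVec f ∈ jacSyz F)
    (h : IsMPOG F e) :
    ∃ ℓ q : S3, ℓ ≠ 0 ∧ MvPolynomial.IsHomogeneous ℓ 1 ∧
      q ≠ 0 ∧ MvPolynomial.IsHomogeneous q 2 ∧
      Submodule.colon (eigenIdeal (pderiv 1 f) (-(pderiv 0 f)) 0) (Ideal.span {F}) =
        Ideal.span {ℓ, q} := by
  have hd := one_le_degree_of_coprime hf hcop
  have hF0 := hsq.ne_zero
  obtain ⟨d1, d2, hsum, v, hv⟩ := h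
  have hδ0 := hamVec_ne_zero hcop
  have hδh := isHomogeneous_hamVec hf
  have hv0h : ∀ i, (v 0 i).IsHomogeneous d1 := hv.hom 0
  have hd1 : d1 ≤ d - 1 := hv.degree_zero_le hδ hδ0 hδh
  choose g hg using fun j => dvd_eulerDet hF hsq hδ (hv.mem j)
  have hg0 : g 0 = 0 := by
    refine eq_zero_of_isHomogeneous_mul hF hF0 (n := d1 + d) ?_ (by omega)
    rw [← hg]
    exact isHomogeneous_eulerDet hf hd hv0h
  have hker : ∀ j, g j = 0 → ∃ h : S3, v j = h • hamVec f := fun j hj =>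
    exists_eq_smul_hamVec hF hF0 (by omega) hcop hδ (hv.mem j) (by rw [hg, hj, zero_mul])
  obtain ⟨a, ha⟩ := hker 0 hg0
  have ha0 : a ≠ 0 := fun h0 => hv.ne_zero 0 (by rw [ha, h0, zero_smul])
  have hd1' : d1 = d - 1 := by
    by_contra hne
    exact ha0 (eq_zero_of_smul_isHomogeneous hδh hδ0 (ha ▸ hv0h) (by omega))
  obtain ⟨b, hb⟩ : ∃ b : S3, hamVec f = b • v 0 :=
    hv.exists_eq_smul_of_lt hδ hδh (show d - 1 < d2 by omega)
  have hne : ∀ j, j ≠ 0 → g j ≠ 0 := fun j hj h0 => by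
    obtain ⟨c, hc⟩ := hker j h0
    refine hv.minimal j ?_
    rw [hc, hb]
    exact Submodule.smul_mem _ _ (Submodule.smul_mem _ _
      (Submodule.subset_span ⟨0, Ne.symm hj, rfl⟩))
  have hhom : ∀ j r, (![d1, d2, d2 + 1] : Fin 3 → ℕ) j + d = r + e → (g j).IsHomogeneous r :=
    fun j r hr => by
      refine isHomogeneous_of_mul hF hF0 ?_
      rw [← hg, ← hr]
      exact isHomogeneous_eulerDet hf hd (hv.hom j)
  refine ⟨g 1, g 2, hne 1 (by decide), hhom 1 1 (show d2 + d = 1 + e by omega),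
    hne 2 (by decide), hhom 2 2 (show d2 + 1 + d = 2 + e by omega), le_antisymm ?_ ?_⟩
  · intro r hr
    obtain ⟨θ, hθ⟩ := mem_colon_eigenIdeal.mp hr
    obtain ⟨η, hη, hηr⟩ :=
      exists_mem_jacSyz_of_eulerDet hf hcop hz hF (by omega) hsq hδ hθ
    obtain ⟨c, rfl⟩ := hv.exists_sum_eq hη
    refine Ideal.mem_span_pair.mpr ⟨c 1, c 2, mul_right_cancel₀ hF0 ?_⟩
    rw [← hηr]
    simp [Fin.sum_univ_three, hg, hg0]
    ring
  · rw [Ideal.span_le]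
    rintro r (rfl | rfl)
    exacts [mem_colon_eigenIdeal.mpr ⟨_, hg 1⟩, mem_colon_eigenIdeal.mpr ⟨_, hg 2⟩]

theorem exists_isMinGenSyz_of_colon_eq_span (hf : f.IsHomogeneous d)
    (hcop : ∀ p : S3, p ∣ pderiv 0 f → p ∣ pderiv 1 f → IsUnit p) (hz : ¬ (X 2 ∣ f))
    (hF : F.IsHomogeneous e) (hde : 2 * d ≤ e) (hsq : Squarefree F) (hδ : hamVec f ∈ jacSyz F)
    {ℓ q : S3} (hℓ0 : ℓ ≠ 0) (hℓ : MvPolynomial.IsHomogeneous ℓ 1) (hq0 : q ≠ 0)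
    (hq : MvPolynomial.IsHomogeneous q 2)
    (hK : Submodule.colon (eigenIdeal (pderiv 1 f) (-(pderiv 0 f)) 0) (Ideal.span {F}) =
      Ideal.span {ℓ, q}) :
    ∃ v, IsMinGenSyz F 3 ![d - 1, e - d + 1, e - d + 2] v := by
  have hd := one_le_degree_of_coprime hf hcop
  have hF0 := hsq.ne_zero
  have hδ0 := hamVec_ne_zero hcop
  have hδh := isHomogeneous_hamVec hf
  have lift : ∀ (g : S3) (r : ℕ), g.IsHomogeneous r → g ∈ Ideal.span {ℓ, q} →
      ∃ η ∈ jacSyz F, (∀ i, (η i).IsHomogeneous (e - d + r)) ∧ eulerDet f η = g * F := by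
    intro g r hgr hg
    rw [← hK] at hg
    obtain ⟨θ, hθ⟩ := mem_colon_eigenIdeal.mp hg
    obtain ⟨η, hη, hηg⟩ :=
      exists_mem_jacSyz_of_eulerDet hf hcop hz hF (by omega) hsq hδ hθ
    refine ⟨homComp (e - d + r) η, homComp_mem_jacSyz hF _ hη,
      fun i => homogeneousComponent_isHomogeneous _ _, ?_⟩
    rw [eulerDet_homComp hf hd, hηg, show e - d + r + d = r + e by omega,
      homogeneousComponent_eq_self (hgr.mul hF)]
  obtain ⟨θ, hθ, hθh, hθℓ⟩ := lift ℓ 1 hℓ (Ideal.subset_span (by simp))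
  obtain ⟨η, hη, hηh, hηq⟩ := lift q 2 hq (Ideal.subset_span (by simp))
  have hdet : ∀ c : Fin 3 → S3, eulerDet f (∑ i, c i • (![hamVec f, θ, η] : Fin 3 → Fin 3 → S3) i)
      = (c 1 * ℓ + c 2 * q) * F := fun c => by
    simp [Fin.sum_univ_three, hθℓ, hηq, eulerDet_hamVec]
    ring
  have hmem : ∀ j, (![hamVec f, θ, η] : Fin 3 → Fin 3 → S3) j ∈ jacSyz F := by
    intro j
    fin_cases j
    exacts [hδ, hθ, hη]
  have hnz : ∀ {g : S3} {x : Fin 3 → S3}, g ≠ 0 → eulerDet f x = g * F → x ≠ 0 := by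
    rintro g x hg hx rfl
    rw [map_zero] at hx
    exact mul_ne_zero hg hF0 hx.symm
  refine ⟨![hamVec f, θ, η], hmem, ?_, ?_, le_antisymm ?_ ?_, ?_, ?_⟩
  · intro j
    fin_cases j
    exacts [hδh, hθh, hηh]
  · intro j
    fin_cases j
    exacts [hδ0, hnz hℓ0 hθℓ, hnz hq0 hηq]
  · rw [Submodule.span_le]
    rintro _ ⟨j, rfl⟩
    exact hmem j
  · intro x hx
    obtain ⟨g, hg⟩ := dvd_eulerDet hF hsq hδ hx
    have hgK : g ∈ Ideal.span {ℓ, q} := hK ▸ mem_colon_eigenIdeal.mpr ⟨x, hg⟩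
    obtain ⟨a, b, rfl⟩ := Ideal.mem_span_pair.mp hgK
    obtain ⟨c, hc⟩ := exists_eq_smul_hamVec hF hF0 (by omega) hcop hδ
      (θ := x - (a • θ + b • η))
      (sub_mem hx (add_mem (Submodule.smul_mem _ _ hθ) (Submodule.smul_mem _ _ hη)))
      (by simp [hg, hθℓ, hηq]; ring)
    refine (Submodule.mem_span_range_iff_exists_fun _).mpr ⟨![c, a, b], ?_⟩
    simp [Fin.sum_univ_three]
    rw [← hc]
    abel
  · intro j hj
    obtain ⟨c, hcj, hc⟩ := mem_span_image_ne_iff.mp hj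
    have hdc := hdet c
    rw [hc] at hdc
    fin_cases j
    · replace hcj : c 0 = 0 := hcj
      refine hδ0 (funext fun i => ?_)
      have h := congrArg (homogeneousComponent (d - 1)) (congrFun hc i)
      simp [Fin.sum_univ_three, hcj, homogeneousComponent_eq_self (hδh i),
        homogeneousComponent_mul_of_lt (hθh i) (show d - 1 < e - d + 1 by omega),
        homogeneousComponent_mul_of_lt (hηh i) (show d - 1 < e - d + 2 by omega)] at h
      simpa using h.symm
    · replace hcj : c 1 = 0 := hcj
      replace hdc : eulerDet f θ = _ := hdc
      rw [hθℓ, hcj, zero_mul, zero_add] at hdc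
      have hℓq := mul_right_cancel₀ hF0 hdc
      have hc2 := eq_zero_of_isHomogeneous_mul hq hq0 (hℓq ▸ hℓ) (by decide)
      exact hℓ0 (by rw [hℓq, hc2, zero_mul])
    · replace hcj : c 2 = 0 := hcj
      replace hdc : eulerDet f η = _ := hdc
      rw [hηq, hcj, zero_mul, add_zero] at hdc
      have hqℓ := mul_right_cancel₀ hF0 hdc
      have hnu : ¬ IsUnit ℓ := fun hu => by
        have := hu.map (constantCoeff (σ := Fin 3) (R := ℂ))
        rw [constantCoeff_of_isHomogeneous hℓ one_ne_zero] at this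
        exact not_isUnit_zero this
      obtain ⟨p, hp, hpℓ⟩ := WfDvdMonoid.exists_irreducible_factor hnu hℓ0
      obtain ⟨i, hi⟩ := exists_not_dvd_eigenMinors hf hcop hz hp.prime
      refine hi (hpℓ.trans ?_)
      have hM : eigenMinors f i ∈ Ideal.span {ℓ, q} := by
        rw [← hK]
        refine mem_colon_eigenIdeal.mpr ⟨Pi.single i F, ?_⟩
        simp [eulerDet_apply, Pi.single_apply, mul_comm]
      obtain ⟨a, b, hab⟩ := Ideal.mem_span_pair.mp hM
      exact ⟨a + b * c 1, by rw [← hab, hqℓ]; ring⟩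
  · refine Fin.monotone_iff_le_succ.mpr fun j => ?_
    fin_cases j
    · exact (show d - 1 ≤ e - d + 1 by omega)
    · exact (show e - d + 1 ≤ e - d + 2 by omega)

theorem isMPOG_iff_and_exponents (hf : f.IsHomogeneous d)
    (hcop : ∀ p : S3, p ∣ pderiv 0 f → p ∣ pderiv 1 f → IsUnit p) (hz : ¬ (X 2 ∣ f))
    (hF : F.IsHomogeneous e) (hF0 : F ≠ 0) (hde : 2 * d ≤ e) (hδ : hamVec f ∈ jacSyz F)
    (hsq : 2 ≤ d → Squarefree F)
    (hone : d = 1 → F ∈ eigenIdeal (pderiv 1 f) (-(pderiv 0 f)) 0) :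
    (IsMPOG F e ↔ ∃ ℓ q : S3, ℓ ≠ 0 ∧ MvPolynomial.IsHomogeneous ℓ 1 ∧
      q ≠ 0 ∧ MvPolynomial.IsHomogeneous q 2 ∧
      Submodule.colon (eigenIdeal (pderiv 1 f) (-(pderiv 0 f)) 0) (Ideal.span {F}) =
        Ideal.span {ℓ, q}) ∧
    ((∃ ℓ q : S3, ℓ ≠ 0 ∧ MvPolynomial.IsHomogeneous ℓ 1 ∧
      q ≠ 0 ∧ MvPolynomial.IsHomogeneous q 2 ∧
      Submodule.colon (eigenIdeal (pderiv 1 f) (-(pderiv 0 f)) 0) (Ideal.span {F}) =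
        Ideal.span {ℓ, q}) → ∃ v, IsMinGenSyz F 3 ![d - 1, e - d + 1, e - d + 2] v) := by
  have hd := one_le_degree_of_coprime hf hcop
  rcases hd.eq_or_lt with rfl | hd2
  · have hK : ¬ ∃ ℓ q : S3, ℓ ≠ 0 ∧ MvPolynomial.IsHomogeneous ℓ 1 ∧
        q ≠ 0 ∧ MvPolynomial.IsHomogeneous q 2 ∧
        Submodule.colon (eigenIdeal (pderiv 1 f) (-(pderiv 0 f)) 0) (Ideal.span {F}) =
          Ideal.span {ℓ, q} := by
      rintro ⟨ℓ, q, -, hℓ, -, hq, hK⟩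
      have h1 : (1 : S3) ∈ Ideal.span {ℓ, q} := by
        rw [← hK, Ideal.mem_colon_span_singleton, one_mul]
        exact hone rfl
      obtain ⟨a, b, hab⟩ := Ideal.mem_span_pair.mp h1
      have := congrArg constantCoeff hab
      simp [constantCoeff_of_isHomogeneous hℓ, constantCoeff_of_isHomogeneous hq] at this
    exact ⟨iff_of_false (not_isMPOG_of_degree_one hf hcop hF hF0 (by omega) hδ) hK,
      fun h => absurd h hK⟩
  · have back : (∃ ℓ q : S3, ℓ ≠ 0 ∧ MvPolynomial.IsHomogeneous ℓ 1 ∧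
        q ≠ 0 ∧ MvPolynomial.IsHomogeneous q 2 ∧
        Submodule.colon (eigenIdeal (pderiv 1 f) (-(pderiv 0 f)) 0) (Ideal.span {F}) =
          Ideal.span {ℓ, q}) → ∃ v, IsMinGenSyz F 3 ![d - 1, e - d + 1, e - d + 2] v := by
      rintro ⟨ℓ, q, hℓ0, hℓ, hq0, hq, hK⟩
      exact exists_isMinGenSyz_of_colon_eq_span hf hcop hz hF hde (hsq hd2) hδ hℓ0 hℓ hq0 hq hK
    exact ⟨⟨colon_eq_span_of_isMPOG hf hcop hz hF hde (hsq hd2) hδ,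
      fun h => ⟨d - 1, e - d + 1, by omega, back h⟩⟩, back⟩

end MinimalGenerators

section Members

variable {f : S3} {d : ℕ}

theorem hamVec_mem_jacSyz_iff {F : S3} : hamVec f ∈ jacSyz F ↔
    pderiv 1 f * pderiv 0 F - pderiv 0 f * pderiv 1 F = 0 := by
  rw [mem_jacSyz, Fin.sum_univ_three]
  simp [hamVec, sub_eq_add_neg]

theorem hamVec_mem_jacSyz_mul {F G : S3} (hF : hamVec f ∈ jacSyz F) (hG : hamVec f ∈ jacSyz G) :
    hamVec f ∈ jacSyz (F * G) := by
  rw [hamVec_mem_jacSyz_iff] at *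
  rw [pderiv_mul, pderiv_mul]
  linear_combination G * hF + F * hG

theorem hamVec_mem_jacSyz_X : hamVec f ∈ jacSyz (X 2) := by
  rw [hamVec_mem_jacSyz_iff, pderiv_X_of_ne (by decide), pderiv_X_of_ne (by decide)]
  ring

theorem hamVec_mem_jacSyz_member (a b : ℂ) :
    hamVec f ∈ jacSyz (C a * f + C b * X 2 ^ d) := by
  rw [hamVec_mem_jacSyz_iff]
  simp
  ring

theorem isHomogeneous_member (hf : f.IsHomogeneous d) (a b : ℂ) :
    (C a * f + C b * X 2 ^ d).IsHomogeneous d :=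
  (hf.C_mul a).add (isHomogeneous_C_mul_X_pow b 2 d)

theorem member_mem_eigenIdeal (hf : f.IsHomogeneous 1)
    (hcop : ∀ p : S3, p ∣ pderiv 0 f → p ∣ pderiv 1 f → IsUnit p) (a b : ℂ) :
    C a * f + C b * X 2 ^ 1 ∈ eigenIdeal (pderiv 1 f) (-(pderiv 0 f)) 0 := by
  set I := eigenIdeal (pderiv 1 f) (-(pderiv 0 f)) 0
  have hconst : ∀ i, pderiv i f = C (coeff 0 (pderiv i f)) := fun i => by
    rw [← homogeneousComponent_zero, homogeneousComponent_eq_self hf.pderiv]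
  have hunit : ∀ i, pderiv i f ≠ 0 → IsUnit (pderiv i f) := fun i hi => by
    rw [hconst] at hi ⊢
    exact (IsUnit.mk0 _ (by simpa using hi)).map C
  have h0 : X 2 * pderiv 0 f ∈ I := mem_eigenIdeal.mpr ⟨![1, 0, 0], by simp [eulerDet_eq]⟩
  have h1 : X 2 * pderiv 1 f ∈ I := mem_eigenIdeal.mpr ⟨![0, 1, 0], by simp [eulerDet_eq]⟩
  have h2 : X 0 * pderiv 0 f + X 1 * pderiv 1 f ∈ I :=
    mem_eigenIdeal.mpr ⟨![0, 0, -1], by simp [eulerDet_eq]⟩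
  have hz : X 2 ∈ I := by
    by_cases hA : pderiv 0 f = 0
    · exact (Ideal.mul_unit_mem_iff_mem _ (hcop _ (by simp [hA]) dvd_rfl)).mp h1
    · exact (Ideal.mul_unit_mem_iff_mem _ (hunit 0 hA)).mp h0
  have hfI : f ∈ I := by
    have hE := euler_identity hf
    rw [Nat.cast_one, one_mul] at hE
    rw [← hE]
    exact add_mem h2 (Ideal.mul_mem_right _ _ hz)
  rw [pow_one]
  exact add_mem (Ideal.mul_mem_left _ _ hfI) (Ideal.mul_mem_left _ _ hz)

theorem not_X_dvd_member (hz : ¬ (X 2 ∣ f)) (hd : d ≠ 0) {a : ℂ} (ha : a ≠ 0) (b : ℂ) :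
    ¬ (X 2 ∣ C a * f + C b * X 2 ^ d) := by
  intro h
  have h1 : (X 2 : S3) ∣ C a * f :=
    (dvd_add_left ((dvd_pow_self _ hd).mul_left _)).mp h
  exact hz (((IsUnit.mk0 a ha).map C).dvd_mul_left.mp h1)

theorem isRelPrime_members (hz : ¬ (X 2 ∣ f)) {a b a' b' : ℂ} (h : a * b' ≠ b * a') :
    IsRelPrime (C a * f + C b * X 2 ^ d) (C a' * f + C b' * X 2 ^ d) := by
  intro p hp hp'
  have hu : IsUnit (C (a * b' - b * a') : S3) := (IsUnit.mk0 _ (sub_ne_zero.mpr h)).map C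
  have hpf : p ∣ f := by
    refine hu.dvd_mul_left.mp ?_
    have := dvd_sub (hp.mul_left (C b')) (hp'.mul_left (C b))
    convert this using 1
    simp only [C_sub, C_mul]
    ring
  have hpz : p ∣ X 2 ^ d := by
    refine hu.dvd_mul_left.mp ?_
    have := dvd_sub (hp'.mul_left (C a)) (hp.mul_left (C a'))
    convert this using 1
    simp only [C_sub, C_mul]
    ring
  obtain ⟨i, -, hi⟩ := (dvd_prime_pow X_prime d).mp hpz
  rcases i with _ | i
  · exact associated_one_iff_isUnit.mp (by simpa using hi)
  · exact absurd (((dvd_pow_self _ (Nat.succ_ne_zero i)).trans hi.symm.dvd).trans hpf) hz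

theorem fst_ne_zero_of_squarefree (hd : 2 ≤ d) {a b : ℂ}
    (h : Squarefree (C a * f + C b * X 2 ^ d)) : a ≠ 0 := by
  rintro rfl
  refine X_prime.not_isUnit (h (X 2) ?_)
  rw [C_0, zero_mul, zero_add, ← pow_two]
  exact (pow_dvd_pow _ hd).mul_left _

end Members

/-- MPOG criterion for unions of members of the pencil `α f + β z^d`. Assume `f_x, f_y`
have no common factor and `L_z : z = 0` is not a component of `C : f = 0`. For `k ≥ 2`
distinct reduced members with product `F_k` (of degree `kd`) and `F'_k = z F_k` (of degree
`kd + 1`), and `δ = f_y ∂_x - f_x ∂_y`, the curve `F_k = 0` (resp. `F'_k = 0`) is MPOG iff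
the ideal quotient `K = I_δ : (F_k)` (resp. `I_δ : (F'_k)`) is generated by a linear form
`ℓ ∈ S₁` and a quadratic form `q ∈ S₂`; and then the exponents are
`(d-1, (k-1)d+1, (k-1)d+2)` (resp. `(d-1, (k-1)d+2, (k-1)d+3)`). -/
theorem statement17 (f : S3) (d k : ℕ) (hhom : f.IsHomogeneous d) (hred : Squarefree f)
    (hcop : ∀ p : S3, p ∣ pderiv 0 f → p ∣ pderiv 1 f → IsUnit p)
    (hz : ¬ (X 2 ∣ f)) (hk : 2 ≤ k)
    (u : Fin k → ℂ × ℂ) (hune : ∀ j, u j ≠ 0)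
    (hdist : ∀ j j', j ≠ j' → (u j).1 * (u j').2 ≠ (u j).2 * (u j').1)
    (hsq : ∀ j, Squarefree (C (u j).1 * f + C (u j).2 * X 2 ^ d)) :
    ((IsMPOG (∏ j, (C (u j).1 * f + C (u j).2 * X 2 ^ d)) (k * d) ↔
        (∃ ℓ q : S3, ℓ ≠ 0 ∧ MvPolynomial.IsHomogeneous ℓ 1 ∧
          q ≠ 0 ∧ MvPolynomial.IsHomogeneous q 2 ∧
          Submodule.colon (eigenIdeal (pderiv 1 f) (-(pderiv 0 f)) 0)
              (Ideal.span {∏ j, (C (u j).1 * f + C (u j).2 * X 2 ^ d)}) =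
            Ideal.span {ℓ, q})) ∧
      ((∃ ℓ q : S3, ℓ ≠ 0 ∧ MvPolynomial.IsHomogeneous ℓ 1 ∧
          q ≠ 0 ∧ MvPolynomial.IsHomogeneous q 2 ∧
          Submodule.colon (eigenIdeal (pderiv 1 f) (-(pderiv 0 f)) 0)
              (Ideal.span {∏ j, (C (u j).1 * f + C (u j).2 * X 2 ^ d)}) =
            Ideal.span {ℓ, q}) →
        ∃ v, IsMinGenSyz (∏ j, (C (u j).1 * f + C (u j).2 * X 2 ^ d)) 3
          ![d - 1, (k - 1) * d + 1, (k - 1) * d + 2] v)) ∧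
    ((IsMPOG (X 2 * ∏ j, (C (u j).1 * f + C (u j).2 * X 2 ^ d)) (k * d + 1) ↔
        (∃ ℓ q : S3, ℓ ≠ 0 ∧ MvPolynomial.IsHomogeneous ℓ 1 ∧
          q ≠ 0 ∧ MvPolynomial.IsHomogeneous q 2 ∧
          Submodule.colon (eigenIdeal (pderiv 1 f) (-(pderiv 0 f)) 0)
              (Ideal.span {X 2 * ∏ j, (C (u j).1 * f + C (u j).2 * X 2 ^ d)}) =
            Ideal.span {ℓ, q})) ∧
      ((∃ ℓ q : S3, ℓ ≠ 0 ∧ MvPolynomial.IsHomogeneous ℓ 1 ∧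
          q ≠ 0 ∧ MvPolynomial.IsHomogeneous q 2 ∧
          Submodule.colon (eigenIdeal (pderiv 1 f) (-(pderiv 0 f)) 0)
              (Ideal.span {X 2 * ∏ j, (C (u j).1 * f + C (u j).2 * X 2 ^ d)}) =
            Ideal.span {ℓ, q}) →
        ∃ v, IsMinGenSyz (X 2 * ∏ j, (C (u j).1 * f + C (u j).2 * X 2 ^ d)) 3
          ![d - 1, (k - 1) * d + 2, (k - 1) * d + 3] v)) := by
  have hd := one_le_degree_of_coprime hhom hcop
  have hδ : hamVec f ∈ jacSyz (∏ j, (C (u j).1 * f + C (u j).2 * X 2 ^ d)) :=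
    Finset.prod_induction _ (fun G => hamVec f ∈ jacSyz G) (fun _ _ => hamVec_mem_jacSyz_mul)
      (by simp [hamVec_mem_jacSyz_iff]) fun j _ => hamVec_mem_jacSyz_member _ _
  have hF : (∏ j, (C (u j).1 * f + C (u j).2 * X 2 ^ d)).IsHomogeneous (k * d) := by
    simpa using IsHomogeneous.prod Finset.univ _ (fun _ => d)
      fun j _ => isHomogeneous_member hhom (u j).1 (u j).2
  have hF' : (X 2 * ∏ j, (C (u j).1 * f + C (u j).2 * X 2 ^ d)).IsHomogeneous (k * d + 1) := by
    rw [add_comm]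
    exact (isHomogeneous_X ℂ 2).mul hF
  have hF0 : ∏ j, (C (u j).1 * f + C (u j).2 * X 2 ^ d) ≠ 0 :=
    Finset.prod_ne_zero_iff.mpr fun j _ => (hsq j).ne_zero
  have hFsq : Squarefree (∏ j, (C (u j).1 * f + C (u j).2 * X 2 ^ d)) :=
    Finset.squarefree_prod_of_pairwise_isCoprime
      (fun i _ j _ hij => isRelPrime_members hz (hdist i j hij)) fun j _ => hsq j
  have hFsq' : 2 ≤ d → Squarefree (X 2 * ∏ j, (C (u j).1 * f + C (u j).2 * X 2 ^ d)) :=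
    fun hd2 => squarefree_mul_iff.mpr ⟨IsRelPrime.prod_right fun j _ =>
      X_prime.irreducible.isRelPrime_iff_not_dvd.mpr
        (not_X_dvd_member hz (by omega) (fst_ne_zero_of_squarefree hd2 (hsq j)) _),
      X_prime.irreducible.squarefree, hFsq⟩
  have hmem : d = 1 → ∏ j, (C (u j).1 * f + C (u j).2 * X 2 ^ d) ∈
      eigenIdeal (pderiv 1 f) (-(pderiv 0 f)) 0 := by
    rintro rfl
    exact Ideal.mem_of_dvd _ (Finset.dvd_prod_of_mem _ (Finset.mem_univ (⟨0, by omega⟩ : Fin k)))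
      (member_mem_eigenIdeal hhom hcop _ _)
  have hkd : 2 * d ≤ k * d := Nat.mul_le_mul_right d hk
  have hsub : k * d - d = (k - 1) * d := (Nat.sub_one_mul k d).symm
  have hsub' : k * d + 1 - d = (k - 1) * d + 1 := by omega
  have h := isMPOG_iff_and_exponents hhom hcop hz hF hF0 hkd hδ (fun _ => hFsq) hmem
  have h' := isMPOG_iff_and_exponents hhom hcop hz hF' (mul_ne_zero (X_ne_zero _) hF0)
    (by omega) (hamVec_mem_jacSyz_mul hamVec_mem_jacSyz_X hδ) hFsq'
    fun h1 => Ideal.mul_mem_left _ _ (hmem h1)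
  rw [hsub] at h
  rw [hsub'] at h'
  exact ⟨h, h'⟩

end
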